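/- arXiv:2305.07156 — 2 statements merged into one kernel-verified Lean document; each statement's English description precedes it below -/
import Mathlib

section
/- For every deletion probability d with 0.68 ≤ d < 1, the capacity of the binary deletion channel satisfies C(BDC_d) ≤ 0.3747·(1−d). Formally: for every real L, if C_n(d)/n converges to L as n → ∞, then L ≤ 0.3747·(1−d). -/
open Finset

/-- Mutual information of a joint distribution `q` on `α × β`, where the output
marginal is supported inside the finite set `Ys`. Terms with zero joint
probability vanish since they are multiplied by `q x y = 0`. -/
noncomputable def MI {α : Type*} [Fintype α] {β : Type*} [DecidableEq β]
    (q : α → β → ℝ) (Ys : Finset β) : ℝ :=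
  ∑ x : α, ∑ y ∈ Ys, q x y *
    Real.logb 2 (q x y / ((∑ y' ∈ Ys, q x y') * (∑ x' : α, q x' y)))

/-- `p` is a probability distribution on the finite type `α`. -/
def IsDist {α : Type*} [Fintype α] (p : α → ℝ) : Prop :=
  (∀ a, 0 ≤ p a) ∧ ∑ a : α, p a = 1

/-- The subsequence of `x` obtained by keeping exactly the positions in `S`. -/
def delOutput {n : ℕ} (x : Fin n → Bool) (S : Finset (Fin n)) : List Bool :=
  (S.sort (· ≤ ·)).map x

/-- All binary strings of length at most `n`. -/
def listsUpTo (n : ℕ) : Finset (List Bool) :=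
  (Finset.range (n + 1)).biUnion
    (fun k => Finset.image (fun v : Fin k → Bool => List.ofFn v) Finset.univ)

/-- Transition probability of the binary deletion channel `W_n^d`:
each bit is deleted independently with probability `d`. -/
noncomputable def Wdel (n : ℕ) (d : ℝ) (x : Fin n → Bool) (y : List Bool) : ℝ :=
  ∑ S : Finset (Fin n),
    if delOutput x S = y then (1 - d) ^ S.card * d ^ (n - S.card) else 0

/-- `C_n(d)`: the supremum of `I(X;Y)` over input distributions on `{0,1}^n`,
where `Y` is the output of the deletion channel `W_n^d` on input `X`. -/
noncomputable def Cdel (n : ℕ) (d : ℝ) : ℝ :=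
  sSup { r | ∃ p : (Fin n → Bool) → ℝ, IsDist p ∧
    r = MI (fun x y => p x * Wdel n d x y) (listsUpTo n) }

/-! ### Logarithmic inequalities -/

theorem mul_log_div_ge {a A r : ℝ} (ha : 0 ≤ a) (hA : 0 ≤ A) (h : A = 0 → a = 0) (hr : 0 < r) :
    a * Real.log r + a - A * r ≤ a * Real.log (a / A) := by
  rcases hA.eq_or_lt with rfl | hA
  · simp [h rfl]
  rcases ha.eq_or_lt with rfl | ha
  · rw [zero_mul, zero_mul]
    nlinarith
  have h1 := Real.add_one_le_exp (Real.log (A * r / a))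
  rw [Real.exp_log (by positivity), Real.log_div (by positivity) ha.ne',
    Real.log_mul hA.ne' hr.ne'] at h1
  rw [Real.log_div ha.ne' hA.ne']
  have h2 := mul_le_mul_of_nonneg_left h1 ha.le
  rw [mul_div_cancel₀ _ ha.ne'] at h2
  linarith

/-- The log-sum inequality for two terms. -/
theorem add_mul_log_div_le {a A b B : ℝ} (ha : 0 ≤ a) (hA : 0 ≤ A) (hb : 0 ≤ b) (hB : 0 ≤ B)
    (h : A = 0 → a = 0) (h' : B = 0 → b = 0) :
    (a + b) * Real.log ((a + b) / (A + B)) ≤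
      a * Real.log (a / A) + b * Real.log (b / B) := by
  rcases (add_nonneg ha hb).eq_or_lt with h0 | h0
  · obtain rfl : a = 0 := by linarith
    obtain rfl : b = 0 := by linarith
    simp
  have hAB : 0 < A + B := by
    refine (add_nonneg hA hB).lt_of_ne fun hAB => h0.ne ?_
    rw [h (by linarith), h' (by linarith), add_zero]
  have hr : 0 < (a + b) / (A + B) := by positivity
  have h1 := mul_log_div_ge ha hA h hr
  have h2 := mul_log_div_ge hb hB h' hr
  have h3 : A * ((a + b) / (A + B)) + B * ((a + b) / (A + B)) = a + b := by field_simp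
  linarith

theorem mul_mul_log_mul_div_mul {c a A : ℝ} :
    (c * a) * Real.log ((c * a) / (c * A)) = c * (a * Real.log (a / A)) := by
  rcases eq_or_ne c 0 with rfl | hc
  · simp
  rw [mul_div_mul_left _ _ hc, mul_assoc]

/-! ### Lists of bounded length -/

theorem mem_listsUpTo {n : ℕ} {y : List Bool} : y ∈ listsUpTo n ↔ y.length ≤ n := by
  simp only [listsUpTo, mem_biUnion, Finset.mem_range, mem_image, mem_univ, true_and]
  constructor
  · rintro ⟨k, hk, v, rfl⟩
    simp; omega
  · intro h
    exact ⟨y.length, by omega, y.get, List.ofFn_get y⟩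

theorem sum_listsUpTo_zero (g : List Bool → ℝ) : ∑ y ∈ listsUpTo 0, g y = g [] := by
  have : listsUpTo 0 = {[]} := by
    ext y
    simp [mem_listsUpTo]
  rw [this, sum_singleton]

theorem sum_listsUpTo_succ (n : ℕ) (g : List Bool → ℝ) :
    ∑ y ∈ listsUpTo (n + 1), g y =
      g [] + ∑ c : Bool, ∑ y ∈ listsUpTo n, g (c :: y) := by
  have : listsUpTo (n + 1) =
      insert [] (univ.biUnion fun c : Bool => (listsUpTo n).image (List.cons c)) := by
    ext y
    cases y with
    | nil => simp [mem_listsUpTo]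
    | cons b y => cases b <;> simp [mem_listsUpTo]
  rw [this, sum_insert (by simp), sum_biUnion]
  · congr 1
    refine sum_congr rfl fun c _ => ?_
    rw [sum_image (by simp)]
  · intro a _ b _ hab
    rw [Function.onFun, Finset.disjoint_left]
    intro y hy hy'
    obtain ⟨u, -, rfl⟩ := mem_image.1 hy
    obtain ⟨v, -, h⟩ := mem_image.1 hy'
    exact hab (List.cons.inj h).1.symm

/-! ### The output law of the deletion channel -/

/-- The probability that the deletion channel turns the first list into the second one. -/
noncomputable def delLaw (d : ℝ) : List Bool → List Bool → ℝ
  | [], [] => 1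
  | [], _ :: _ => 0
  | _ :: x, [] => d * delLaw d x []
  | c :: x, b :: y => (1 - d) * (if b = c then delLaw d x y else 0) + d * delLaw d x (b :: y)

theorem delLaw_nonneg {d : ℝ} (h0 : 0 ≤ d) (h1 : d ≤ 1) (x y : List Bool) : 0 ≤ delLaw d x y := by
  have : 0 ≤ 1 - d := by linarith
  induction x generalizing y with
  | nil => cases y <;> simp [delLaw]
  | cons c x ih =>
    cases y with
    | nil => exact mul_nonneg h0 (ih _)
    | cons b y =>
      have h2 := ih y
      have h3 := ih (b :: y)
      rw [delLaw]
      split_ifs <;> positivity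

theorem sum_delLaw_cons (d : ℝ) (n : ℕ) (c : Bool) (x : List Bool) (g : List Bool → ℝ) :
    ∑ y ∈ listsUpTo (n + 1), delLaw d (c :: x) y * g y =
      (1 - d) * ∑ y ∈ listsUpTo n, delLaw d x y * g (c :: y) +
        d * ∑ y ∈ listsUpTo (n + 1), delLaw d x y * g y := by
  simp only [sum_listsUpTo_succ, Fintype.sum_bool, delLaw, mul_add, mul_sum]
  cases c <;> simp [add_mul, sum_add_distrib, mul_assoc] <;> ring

theorem sum_delLaw (d : ℝ) {n : ℕ} {x : List Bool} (h : x.length ≤ n) :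
    ∑ y ∈ listsUpTo n, delLaw d x y = 1 := by
  induction x generalizing n with
  | nil =>
    cases n with
    | zero => simp [sum_listsUpTo_zero, delLaw]
    | succ n => simp [sum_listsUpTo_succ, delLaw]
  | cons c x ih =>
    obtain ⟨n, rfl⟩ : ∃ m, n = m + 1 := ⟨n - 1, by simp at h; omega⟩
    have := sum_delLaw_cons d n c x fun _ => 1
    simp only [mul_one] at this
    rw [this, ih (by simpa using h), ih (by simp at h; omega)]
    ring

theorem delOutput_map_succ {n : ℕ} (x : Fin (n + 1) → Bool) (S : Finset (Fin n)) :
    delOutput x (S.map (Fin.succEmb n)) = delOutput (fun i => x i.succ) S := by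
  have : (S.sort (· ≤ ·)).map (Fin.succEmb n) = (S.map (Fin.succEmb n)).sort (· ≤ ·) :=
    Finset.map_sort _ _ _ _ (by simp)
  rw [delOutput, delOutput, ← this, List.map_map]
  rfl

theorem delOutput_cons_map_succ {n : ℕ} (x : Fin (n + 1) → Bool) (S : Finset (Fin n)) :
    delOutput x (insert 0 (S.map (Fin.succEmb n))) =
      x 0 :: delOutput (fun i => x i.succ) S := by
  rw [← delOutput_map_succ, delOutput, sort_insert]
  · rfl
  · simp
  · simp [Fin.succ_ne_zero]

theorem Wdel_eq_delLaw (n : ℕ) (d : ℝ) (x : Fin n → Bool) (y : List Bool) :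
    Wdel n d x y = delLaw d (List.ofFn x) y := by
  induction n generalizing y with
  | zero =>
    have : (univ : Finset (Finset (Fin 0))) = {∅} := rfl
    rw [Wdel, this, sum_singleton]
    cases y <;> simp [delOutput, delLaw]
  | succ n ih =>
    have h1 : (univ : Finset (Finset (Fin (n + 1)))) =
        (insert 0 (univ.map (Fin.succEmb n))).powerset := by
      rw [← powerset_univ, Fin.univ_succ, cons_eq_insert]; rfl
    have h2 : (univ.map (Fin.succEmb n)).powerset =
        (univ : Finset (Finset (Fin n))).image (fun S => S.map (Fin.succEmb n)) := by
      rw [map_eq_image, powerset_image, powerset_univ]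
      simp [map_eq_image]
    have hinj : Set.InjOn (fun S : Finset (Fin n) => S.map (Fin.succEmb n))
        (univ : Finset (Finset (Fin n))) :=
      fun S _ S' _ h => Finset.map_injective _ h
    have hcard : ∀ S : Finset (Fin n), S.card ≤ n := fun S => by simpa using S.card_le_univ
    rw [Wdel, h1, sum_powerset_insert (by simp [Fin.succ_ne_zero]), h2, sum_image hinj,
      sum_image hinj, List.ofFn_succ]
    have h3 : ∀ S : Finset (Fin n), (insert 0 (S.map (Fin.succEmb n))).card = S.card + 1 :=
      fun S => by rw [card_insert_of_notMem (by simp [Fin.succ_ne_zero]), card_map]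
    simp only [delOutput_map_succ, delOutput_cons_map_succ, h3, card_map]
    have h4 : ∀ y, ∑ S : Finset (Fin n), (if delOutput (fun i => x i.succ) S = y then
        (1 - d) ^ S.card * d ^ (n + 1 - S.card) else 0) =
        d * delLaw d (List.ofFn fun i => x i.succ) y := by
      intro y
      rw [← ih, Wdel, mul_sum]
      refine sum_congr rfl fun S _ => ?_
      rw [mul_ite, mul_zero, Nat.succ_sub (hcard S), pow_succ]
      congr 1; ring
    rw [h4]
    cases y with
    | nil => simp [delLaw]
    | cons b y =>
      rw [delLaw, add_comm]
      congr 1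
      rw [← ih, Wdel]
      by_cases hb : b = x 0
      · subst hb
        simp only [List.cons.injEq, true_and, if_true, mul_sum]
        refine sum_congr rfl fun S _ => ?_
        rw [mul_ite, mul_zero, Nat.add_sub_add_right, pow_succ]
        congr 1; ring
      · simp [hb, Ne.symm hb]

/-! ### Concatenation of deletion channels -/

/-- The expectation of `g` at the random sublist of `x` that keeps each entry with probability
`p`. -/
noncomputable def sublistMean (p : ℝ) : List Bool → (List Bool → ℝ) → ℝ
  | [], g => g []
  | c :: x, g => p * sublistMean p x (fun z => g (c :: z)) + (1 - p) * sublistMean p x g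

theorem sublistMean_add (p : ℝ) (x : List Bool) (g h : List Bool → ℝ) :
    sublistMean p x (fun z => g z + h z) = sublistMean p x g + sublistMean p x h := by
  induction x generalizing g h with
  | nil => rfl
  | cons c x ih => simp only [sublistMean, ih]; ring

theorem sublistMean_const_mul (p a : ℝ) (x : List Bool) (g : List Bool → ℝ) :
    sublistMean p x (fun z => a * g z) = a * sublistMean p x g := by
  induction x generalizing g with
  | nil => rfl
  | cons c x ih => simp only [sublistMean, ih]; ring

theorem sublistMean_const (p a : ℝ) (x : List Bool) : sublistMean p x (fun _ => a) = a := by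
  induction x with
  | nil => rfl
  | cons c x ih => simp only [sublistMean, ih]; ring

theorem sublistMean_length (p : ℝ) (x : List Bool) :
    sublistMean p x (fun z => (z.length : ℝ)) = p * x.length := by
  induction x with
  | nil => simp [sublistMean]
  | cons c x ih =>
    simp only [sublistMean, List.length_cons, Nat.cast_add, Nat.cast_one, sublistMean_add, ih,
      sublistMean_const]
    ring

theorem sublistMean_sum {ι : Type*} (p : ℝ) (x : List Bool) (s : Finset ι)
    (g : ι → List Bool → ℝ) :
    sublistMean p x (fun z => ∑ i ∈ s, g i z) = ∑ i ∈ s, sublistMean p x (g i) := by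
  classical
  induction s using Finset.induction_on with
  | empty => simp [sublistMean_const]
  | insert i s hi ih => simp only [sum_insert hi, sublistMean_add, ih]

theorem sublistMean_mono {p : ℝ} (h0 : 0 ≤ p) (h1 : p ≤ 1) {x : List Bool} {g h : List Bool → ℝ}
    (H : ∀ z, z.length ≤ x.length → g z ≤ h z) : sublistMean p x g ≤ sublistMean p x h := by
  have h2 : 0 ≤ 1 - p := by linarith
  induction x generalizing g h with
  | nil => exact H [] le_rfl
  | cons c x ih =>
    refine add_le_add (mul_le_mul_of_nonneg_left (ih fun z hz => H _ ?_) h0)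
      (mul_le_mul_of_nonneg_left (ih fun z hz => H _ ?_) h2)
    · simpa using hz
    · simp; omega

theorem sublistMean_convexOn {p : ℝ} (h0 : 0 ≤ p) (h1 : p ≤ 1) {f : ℝ → ℝ}
    (hf : ConvexOn ℝ (Set.Ici 0) f) (x : List Bool) {g : List Bool → ℝ} (hg : ∀ z, 0 ≤ g z) :
    f (sublistMean p x g) ≤ sublistMean p x (fun z => f (g z)) := by
  have h2 : 0 ≤ 1 - p := by linarith
  induction x generalizing g with
  | nil => exact le_rfl
  | cons c x ih =>
    have hn : ∀ k : List Bool → ℝ, (∀ z, 0 ≤ k z) → 0 ≤ sublistMean p x k := fun k hk => by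
      simpa [sublistMean_const] using sublistMean_mono (x := x) h0 h1 fun z _ => hk z
    refine (hf.2 (hn (fun z => g (c :: z)) fun _ => hg _) (hn g hg) h0 h2 (by ring)).trans ?_
    exact add_le_add (mul_le_mul_of_nonneg_left (ih fun _ => hg _) h0)
      (mul_le_mul_of_nonneg_left (ih hg) h2)

theorem sublistMean_delLaw (p d : ℝ) (x y : List Bool) :
    sublistMean p x (fun z => delLaw d z y) = delLaw (1 - p * (1 - d)) x y := by
  induction x generalizing y with
  | nil => cases y <;> rfl
  | cons c x ih =>
    cases y with
    | nil =>
      simp only [sublistMean, delLaw, sublistMean_const_mul, ih]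
      ring
    | cons b y =>
      simp only [sublistMean, delLaw, sublistMean_add, sublistMean_const_mul, ih]
      split_ifs
      · rw [ih]; ring
      · rw [sublistMean_const]; ring

theorem convexOn_mul_log_div {r : ℝ} (hr : 0 < r) :
    ConvexOn ℝ (Set.Ici 0) fun t => t * Real.log (t / r) := by
  refine ⟨convex_Ici 0, fun s hs t ht a b ha hb hab => ?_⟩
  have := add_mul_log_div_le (a := a * s) (A := a * r) (b := b * t) (B := b * r)
    (mul_nonneg ha hs) (by positivity) (mul_nonneg hb ht) (by positivity)
    (fun h => by simp [(mul_eq_zero.1 h).resolve_right hr.ne'])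
    (fun h => by simp [(mul_eq_zero.1 h).resolve_right hr.ne'])
  rwa [mul_mul_log_mul_div_mul, mul_mul_log_mul_div_mul, ← add_mul, hab, one_mul] at this

/-! ### Mutual information is bounded by the largest divergence from a fixed law -/

theorem MI_le {α β : Type*} [Fintype α] [DecidableEq β] {p : α → ℝ} (hp : IsDist p)
    {W : α → β → ℝ} {Ys : Finset β} (hW : ∀ x y, 0 ≤ W x y) (hW1 : ∀ x, ∑ y ∈ Ys, W x y = 1)
    {Q : β → ℝ} (hQ : ∀ y, 0 < Q y) (hQ1 : ∑ y ∈ Ys, Q y ≤ 1) {C : ℝ}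
    (hC : ∀ x, ∑ y ∈ Ys, W x y * Real.log (W x y / Q y) ≤ C) :
    MI (fun x y => p x * W x y) Ys ≤ C / Real.log 2 := by
  obtain ⟨hp0, hp1⟩ := hp
  have hlog : 0 < Real.log 2 := Real.log_pos one_lt_two
  rw [le_div_iff₀ hlog, MI, sum_mul]
  set m : β → ℝ := fun y => ∑ x, p x * W x y with hm
  have hm0 : ∀ x y, 0 ≤ p x * W x y := fun x y => mul_nonneg (hp0 x) (hW x y)
  have key : ∀ x y, p x * W x y * Real.logb 2 (p x * W x y / ((∑ y' ∈ Ys, p x * W x y') * m y)) *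
      Real.log 2 = p x * (W x y * Real.log (W x y / Q y)) -
        p x * W x y * Real.log (m y / Q y) := by
    intro x y
    rcases (hm0 x y).eq_or_lt with h | h
    · rw [← mul_assoc (p x), ← h]; simp
    have hpx : 0 < p x := (hp0 x).lt_of_ne fun h' => by simp [← h'] at h
    have hWx : 0 < W x y := (hW x y).lt_of_ne fun h' => by simp [← h'] at h
    have hmy : 0 < m y := h.trans_le (single_le_sum (fun x _ => hm0 x y) (mem_univ x))
    have hQy := hQ y
    rw [← mul_sum, hW1, mul_one, mul_div_mul_left _ _ hpx.ne', Real.logb,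
      mul_assoc, div_mul_cancel₀ _ hlog.ne', Real.log_div hWx.ne' hmy.ne',
      Real.log_div hWx.ne' hQy.ne', Real.log_div hmy.ne' hQy.ne']
    ring
  have h1 : ∑ x, p x * ∑ y ∈ Ys, W x y * Real.log (W x y / Q y) ≤ C :=
    (sum_le_sum fun x _ => mul_le_mul_of_nonneg_left (hC x) (hp0 x)).trans_eq
      (by rw [← sum_mul, hp1, one_mul])
  have h2 : 0 ≤ ∑ x, ∑ y ∈ Ys, p x * W x y * Real.log (m y / Q y) := by
    rw [sum_comm]
    have h3 : ∑ y ∈ Ys, m y = 1 := by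
      rw [hm, sum_comm]
      simp only [← mul_sum, hW1, mul_one, hp1]
    have h4 : ∀ y ∈ Ys, m y - Q y ≤ ∑ x, p x * W x y * Real.log (m y / Q y) := fun y _ => by
      rw [← sum_mul]
      have := mul_log_div_ge (a := m y) (A := Q y) (r := 1)
        (sum_nonneg fun x _ => hm0 x y) (hQ y).le (fun h => ((hQ y).ne' h).elim) one_pos
      simpa using this
    have h5 := sum_le_sum h4
    rw [sum_sub_distrib, h3] at h5
    linarith
  calc _ = ∑ x, (p x * ∑ y ∈ Ys, W x y * Real.log (W x y / Q y) -
      ∑ y ∈ Ys, p x * W x y * Real.log (m y / Q y)) := by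
        refine sum_congr rfl fun x _ => ?_
        rw [sum_mul, mul_sum, ← sum_sub_distrib]
        exact sum_congr rfl fun y _ => key x y
    _ ≤ C := by rw [sum_sub_distrib]; linarith

/-- Eight numbers indexed by the words of length three over `Bool`. -/
structure Oct (α : Type) where
  x0 : α
  x1 : α
  x2 : α
  x3 : α
  x4 : α
  x5 : α
  x6 : α
  x7 : α

/-- Twice the effect, on the law of the first three output bits, of prepending the bit `c` to the
input of the deletion channel with deletion probability `1/2`. -/
def Oct.step {α : Type} [Add α] : Bool → Oct α → Oct α
  | false, v => ⟨v.x0 + (v.x0 + v.x1), v.x1 + (v.x2 + v.x3), v.x2 + (v.x4 + v.x5),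
      v.x3 + (v.x6 + v.x7), v.x4, v.x5, v.x6, v.x7⟩
  | true, v => ⟨v.x0, v.x1, v.x2, v.x3, v.x4 + (v.x0 + v.x1), v.x5 + (v.x2 + v.x3),
      v.x6 + (v.x4 + v.x5), v.x7 + (v.x6 + v.x7)⟩

/-- The number whose binary digits are the first `k` bits of `z`, padded with zeros. -/
def prefixIndex : ℕ → List Bool → ℕ
  | 0, _ => 0
  | k + 1, z => (z.headD false).toNat * 2 ^ k + prefixIndex k z.tail

/-- A table of 1024 bytes, the values of the potential. -/
def potentialTable : ℕ :=
  1756221879533333290639429189009664738959084202943311856724085988261501263280574822912711496572220074572494664738144470143788765459789798646073545231224895305951047368561128819161071697432362154274759738500253552821263026861573217850374752420780793443715254441783517956257070811227058181259524646307027680862182354418063325562464972335066470982516072568002951246434812051803665168491023582926917136668460027101337843671054023890671380858874750564929457348209209029378601547511896743041129341852583981700844115866413072138638557730803346726445034034248808216455680005662741264404771853468849580949929741991834271741971344517679166429643828472010021704610015917662273232794901397449084584247295494049713803180911867794885941454702714148032362580112179557097406152555592032832724706327842309874278005948456189867498810267432021179940141655807010319288299631656151489590346882793110022659243613617516467394897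32537677633711025782670096166492303023182293639734635129126116020441306473597067472722869057181821306365978329600420796437831970756063446150699404213125029855657580766731058357594385962447602558068802052817954541254555054292065557826984687967119683197753096763584307046511765955469104528684777393534163212561791101220297235264674497370524192535134890891606927392198949509339590249704939550623860081586945177962815019094845305644665081351290731508986706438174005297414799496038308040245929004497064553979628678896270464165801167294044679383771132410067565484224554577503731747564524562185636625684321141459392682787921897797550895347711486612027929523733213821172069592408179644889616625499261195844724526475697011192438108985709427904799496534551620510970388514809063430823893723153759463274976534929219074627971990423816244814222753566823285971525494240876556214294780068238817626100513248976109423181111361798994683119522214917194587967361597288450203943831093797890688342470153148663146663665212659855151947521140702270809456432139395376492248466952238930005079885569834153378837935307110467190397201241963518765241015218872915179200199326086842528875858271693384967409101299644771170451984178297009305479346431692474974104778716131269551772848237735360463180228674553490061955711794621670974373697048617181961860770657157678484488562413145866399108335426280598949846758884255059231278090034846906938394515101803370856351332135903660007299054151603816122318945940128020452860381547108714498925461162679689645592172077405430552786911865688308209598065633409065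

/-- The potential of an input string, depending on its first ten bits only. -/
def potential (z : List Bool) : ℕ :=
  potentialTable / 2 ^ (8 * prefixIndex 10 z) % 256

/-- The exponentiated form of the inequality between the divergence of the law `v / 2048` from the
Markov kernel with weights `50/64, 14/64, 38/64, 26/64` and the drop in potential. -/
def Oct.certified (s t : ℕ) (v : Oct ℕ) : Bool :=
  Nat.ble
    (v.x0 ^ v.x0 * v.x1 ^ v.x1 * (v.x2 ^ v.x2 * v.x3 ^ v.x3) *
      (v.x4 ^ v.x4 * v.x5 ^ v.x5 * (v.x6 ^ v.x6 * v.x7 ^ v.x7)) *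
      2 ^ (12288 + 16 * t))
    ((v.x0 + v.x1) ^ (v.x0 + v.x1) * (v.x2 + v.x3) ^ (v.x2 + v.x3) *
      ((v.x4 + v.x5) ^ (v.x4 + v.x5) * (v.x6 + v.x7) ^ (v.x6 + v.x7)) *
      (50 ^ (v.x0 + v.x7) * 14 ^ (v.x1 + v.x6) * (26 ^ (v.x2 + v.x5) * 38 ^ (v.x3 + v.x4))) *
      2 ^ (767 + 16 * s))

/-- Application of `f` to `n`, arranged so that the kernel evaluates `n` first. -/
def applyEval (n : ℕ) (f : ℕ → Bool) : Bool :=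
  Nat.rec (f 0) (fun m _ => f (m + 1)) n

/-- Application of `f` to `v`, arranged so that the kernel evaluates the entries of `v` first. -/
def Oct.applyEval (v : Oct ℕ) (f : Oct ℕ → Bool) : Bool :=
  _root_.applyEval v.x0 fun a0 => _root_.applyEval v.x1 fun a1 =>
  _root_.applyEval v.x2 fun a2 => _root_.applyEval v.x3 fun a3 =>
  _root_.applyEval v.x4 fun a4 => _root_.applyEval v.x5 fun a5 =>
  _root_.applyEval v.x6 fun a6 => _root_.applyEval v.x7 fun a7 =>
    f ⟨a0, a1, a2, a3, a4, a5, a6, a7⟩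

/-- Checks the certificate for all inputs obtained from `u` by prepending `k` bits. -/
def certifiedAll : ℕ → List Bool → Oct ℕ → Bool
  | 0, u, v => v.certified (potential u) (potential u.tail)
  | k + 1, u, v => (v.step false).applyEval (certifiedAll k (false :: u)) &&
      (v.step true).applyEval (certifiedAll k (true :: u))

/-- The certificate is valid for all inputs of length 11 followed by an input with arbitrary law of
the first three output bits. -/
theorem certifiedAll_unit :
    certifiedAll 11 [] ⟨1, 0, 0, 0, 0, 0, 0, 0⟩ ∧ certifiedAll 11 [] ⟨0, 1, 0, 0, 0, 0, 0, 0⟩ ∧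
    certifiedAll 11 [] ⟨0, 0, 1, 0, 0, 0, 0, 0⟩ ∧ certifiedAll 11 [] ⟨0, 0, 0, 1, 0, 0, 0, 0⟩ ∧
    certifiedAll 11 [] ⟨0, 0, 0, 0, 1, 0, 0, 0⟩ ∧ certifiedAll 11 [] ⟨0, 0, 0, 0, 0, 1, 0, 0⟩ ∧
    certifiedAll 11 [] ⟨0, 0, 0, 0, 0, 0, 1, 0⟩ ∧ certifiedAll 11 [] ⟨0, 0, 0, 0, 0, 0, 0, 1⟩ := by
  decide +kernel
/-! ### The law of the first three output bits -/

/-- The entry at the word `a, b, e`. -/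
def Oct.get {α : Type} (v : Oct α) : Bool → Bool → Bool → α
  | false, false, false => v.x0
  | false, false, true => v.x1
  | false, true, false => v.x2
  | false, true, true => v.x3
  | true, false, false => v.x4
  | true, false, true => v.x5
  | true, true, false => v.x6
  | true, true, true => v.x7

theorem Oct.get_step {α : Type} [Add α] (c : Bool) (v : Oct α) (a b e : Bool) :
    (v.step c).get a b e =
      if a = c then v.get a b e + (v.get b e false + v.get b e true) else v.get a b e := by
  cases a <;> cases b <;> cases e <;> cases c <;> rfl

/-- Entrywise operations on octuples. -/
def Oct.map {α β : Type} (f : α → β) (v : Oct α) : Oct β :=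
  ⟨f v.x0, f v.x1, f v.x2, f v.x3, f v.x4, f v.x5, f v.x6, f v.x7⟩

instance Oct.instAdd {α : Type} [Add α] : Add (Oct α) :=
  ⟨fun v w => ⟨v.x0 + w.x0, v.x1 + w.x1, v.x2 + w.x2, v.x3 + w.x3, v.x4 + w.x4, v.x5 + w.x5,
    v.x6 + w.x6, v.x7 + w.x7⟩⟩

instance Oct.instSMul : SMul ℝ (Oct ℝ) := ⟨fun r => Oct.map (r * ·)⟩

theorem Oct.get_smul (r : ℝ) (v : Oct ℝ) (a b e : Bool) :
    (r • v).get a b e = r * v.get a b e := by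
  cases a <;> cases b <;> cases e <;> rfl

theorem Oct.get_add (v w : Oct ℝ) (a b e : Bool) :
    (v + w).get a b e = v.get a b e + w.get a b e := by
  cases a <;> cases b <;> cases e <;> rfl

theorem Oct.ext_get {v w : Oct ℝ} (h : ∀ a b e, v.get a b e = w.get a b e) : v = w := by
  have := h false false false
  have := h false false true
  have := h false true false
  have := h false true true
  have := h true false false
  have := h true false true
  have := h true true false
  have := h true true true
  cases v; cases w
  simp_all [Oct.get]

/-- The law of the first three output bits for the input `u ++ z`, where `v` is that law for the
input `z`. -/
noncomputable def prependLaw (u : List Bool) (v : Oct ℝ) : Oct ℝ :=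
  u.foldr (fun c v => (1 / 2 : ℝ) • v.step c) v

/-- The law of the first three output bits of the deletion channel with deletion probability `1/2`,
where the output is padded with zeros. -/
noncomputable def firstLaw (z : List Bool) : Oct ℝ :=
  prependLaw z ⟨1, 0, 0, 0, 0, 0, 0, 0⟩

theorem get_firstLaw_cons (c : Bool) (z : List Bool) (a b e : Bool) :
    (firstLaw (c :: z)).get a b e =
      1 / 2 * (if a = c then (firstLaw z).get b e false + (firstLaw z).get b e true else 0) +
        1 / 2 * (firstLaw z).get a b e := by
  rw [show firstLaw (c :: z) = (1 / 2 : ℝ) • (firstLaw z).step c from rfl, Oct.get_smul,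
    Oct.get_step]
  split_ifs <;> ring

theorem firstLaw_nonneg (z : List Bool) (a b e : Bool) : 0 ≤ (firstLaw z).get a b e := by
  induction z generalizing a b e with
  | nil => cases a <;> cases b <;> cases e <;> simp [firstLaw, prependLaw, Oct.get]
  | cons c z ih =>
    have h1 := ih a b e
    have h2 := ih b e false
    have h3 := ih b e true
    rw [get_firstLaw_cons]
    split_ifs <;> positivity

theorem sum_delLaw_mul_first (n : ℕ) {z : List Bool} (h : z.length ≤ n)
    (g : Bool → Bool → Bool → ℝ) :
    ∑ y ∈ listsUpTo n, delLaw (1 / 2) z y * g (y.getD 0 false) (y.getD 1 false) (y.getD 2 false) =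
      ∑ a, ∑ b, ∑ e, (firstLaw z).get a b e * g a b e := by
  induction z generalizing n g with
  | nil =>
    cases n <;>
      simp [sum_listsUpTo_zero, sum_listsUpTo_succ, delLaw, firstLaw, prependLaw, Oct.get]
  | cons c z ih =>
    obtain ⟨n, rfl⟩ : ∃ m, n = m + 1 := ⟨n - 1, by simp at h; omega⟩
    have h1 := ih n (by simpa using h) fun a b _ => g c a b
    rw [sum_delLaw_cons, ih (n + 1) (by simp at h; omega)]
    simp only [List.getD_cons_zero, List.getD_cons_succ]
    rw [h1]
    simp only [get_firstLaw_cons, Fintype.sum_bool]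
    cases c <;> simp <;> ring

theorem sum_firstLaw (z : List Bool) : ∑ a, ∑ b, ∑ e, (firstLaw z).get a b e = 1 := by
  have := sum_delLaw_mul_first z.length le_rfl fun _ _ _ => 1
  simp only [mul_one] at this
  rw [← this, sum_delLaw _ le_rfl]

theorem firstLaw_le_one (z : List Bool) (a b e : Bool) : (firstLaw z).get a b e ≤ 1 := by
  have h1 := firstLaw_nonneg z
  rw [← sum_firstLaw z]
  exact (single_le_sum (f := fun e => (firstLaw z).get a b e) (fun i _ => h1 a b i)
    (mem_univ e)).trans <|
    (single_le_sum (f := fun b => ∑ e, (firstLaw z).get a b e)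
      (fun i _ => sum_nonneg fun j _ => h1 a i j) (mem_univ b)).trans
    (single_le_sum (f := fun a => ∑ b, ∑ e, (firstLaw z).get a b e)
      (fun i _ => sum_nonneg fun j _ => sum_nonneg fun k _ => h1 i j k) (mem_univ a))

theorem delLaw_le_firstLaw (z y : List Bool) :
    delLaw (1 / 2) z y ≤ (firstLaw z).get (y.getD 0 false) (y.getD 1 false) (y.getD 2 false) := by
  induction z generalizing y with
  | nil =>
    cases y with
    | nil => simp [delLaw, firstLaw, prependLaw, Oct.get]
    | cons b y => simpa only [delLaw] using firstLaw_nonneg [] _ _ _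
  | cons c z ih =>
    rw [get_firstLaw_cons]
    cases y with
    | nil =>
      have h1 := ih []
      have h2 := firstLaw_nonneg z false false false
      have h3 := firstLaw_nonneg z false false true
      simp only [delLaw]
      simp only [List.getD_nil] at h1 ⊢
      cases c <;> simp <;> linarith
    | cons b y =>
      have h1 := ih y
      have h2 := ih (b :: y)
      have h3 := firstLaw_nonneg z (y.getD 0 false) (y.getD 1 false)
      have h4 : delLaw (1 / 2) z y ≤ (firstLaw z).get (y.getD 0 false) (y.getD 1 false) false +
          (firstLaw z).get (y.getD 0 false) (y.getD 1 false) true := by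
        have h5 := h3 false
        have h6 := h3 true
        cases h : y.getD 2 false <;> rw [h] at h1 <;> linarith
      simp only [delLaw]
      simp only [List.getD_cons_zero, List.getD_cons_succ] at h2 ⊢
      split_ifs <;> linarith

/-! ### The reference Markov law -/

/-- The transition probability from the last two bits `a, b` to the bit `e`. -/
noncomputable def markovKernel (a b e : Bool) : ℝ :=
  if a = b then (if e = b then 50 / 64 else 14 / 64) else (if e = b then 38 / 64 else 26 / 64)

theorem markovKernel_pos (a b e : Bool) : 0 < markovKernel a b e := by
  unfold markovKernel
  split_ifs <;> norm_num

theorem sum_markovKernel (a b : Bool) : ∑ e, markovKernel a b e = 1 := by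
  cases a <;> cases b <;> simp [markovKernel] <;> norm_num

/-- The product of the transition probabilities along the word `y` followed by three zeros, where
the first three letters are free. -/
noncomputable def markovWeight : List Bool → ℝ
  | [] => 1
  | _ :: y => markovKernel (y.getD 0 false) (y.getD 1 false) (y.getD 2 false) * markovWeight y

theorem markovWeight_pos (y : List Bool) : 0 < markovWeight y := by
  induction y with
  | nil => exact one_pos
  | cons c y ih => exact mul_pos (markovKernel_pos _ _ _) ih

theorem sum_markovWeight_mul_le (n : ℕ) {g : Bool → Bool → Bool → ℝ} (hg : ∀ a b e, 0 ≤ g a b e) :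
    ∑ y ∈ listsUpTo n, markovWeight y * g (y.getD 0 false) (y.getD 1 false) (y.getD 2 false) ≤
      (n + 1) * ∑ a, ∑ b, ∑ e, g a b e := by
  have h0 : ∀ {g : Bool → Bool → Bool → ℝ}, (∀ a b e, 0 ≤ g a b e) →
      g false false false ≤ ∑ a, ∑ b, ∑ e, g a b e := by
    intro g hg
    simp only [Fintype.sum_bool]
    linarith [hg false false true, hg false true false, hg false true true, hg true false false,
      hg true false true, hg true true false, hg true true true]
  induction n generalizing g with
  | zero => simpa [sum_listsUpTo_zero, markovWeight] using h0 hg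
  | succ n ih =>
    have h0 := h0 hg
    have h1 : ∀ c, ∑ y ∈ listsUpTo n, markovWeight (c :: y) *
        g c (y.getD 0 false) (y.getD 1 false) ≤ (n + 1) * ∑ a, ∑ b, g c a b := by
      intro c
      have h2 := @ih (fun a b e => markovKernel a b e * g c a b)
        (fun a b e => mul_nonneg (markovKernel_pos _ _ _).le (hg _ _ _))
      have h3 : ∀ a b, ∑ e, markovKernel a b e * g c a b = g c a b := fun a b => by
        rw [← sum_mul, sum_markovKernel, one_mul]
      simp only [h3] at h2
      refine (le_of_eq (sum_congr rfl fun y _ => ?_)).trans h2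
      rw [markovWeight]; ring
    rw [sum_listsUpTo_succ]
    simp only [List.getD_cons_zero, List.getD_cons_succ, List.getD_nil, markovWeight, one_mul]
      at h1 ⊢
    have h4 := sum_le_sum fun c (_ : c ∈ (univ : Finset Bool)) => h1 c
    rw [← mul_sum] at h4
    push_cast
    linarith

/-! ### Divergence from the Markov kernel -/

/-- The divergence of `v` from the law with the same marginal on the first two letters and the
transition probabilities `markovKernel`. -/
noncomputable def Oct.divergence (v : Oct ℝ) : ℝ :=
  ∑ a, ∑ b, ∑ e, v.get a b e *
    Real.log (v.get a b e / ((v.get a b false + v.get a b true) * markovKernel a b e))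

/-- The octuple `v` is nonnegative and has divergence at most `κ` per unit of mass. -/
def Oct.DivergenceLE (κ : ℝ) (v : Oct ℝ) : Prop :=
  (∀ a b e, 0 ≤ v.get a b e) ∧ v.divergence ≤ κ * ∑ a, ∑ b, ∑ e, v.get a b e

theorem Oct.marginal_mul_eq_zero {v : Oct ℝ} (hv : ∀ a b e, 0 ≤ v.get a b e) {a b e : Bool}
    (h : (v.get a b false + v.get a b true) * markovKernel a b e = 0) : v.get a b e = 0 := by
  have h0 := (mul_eq_zero.1 h).resolve_right (markovKernel_pos a b e).ne'
  have h1 := hv a b false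
  have h2 := hv a b true
  cases e <;> linarith

theorem Oct.marginal_mul_nonneg {v : Oct ℝ} (hv : ∀ a b e, 0 ≤ v.get a b e) (a b e : Bool) :
    0 ≤ (v.get a b false + v.get a b true) * markovKernel a b e :=
  mul_nonneg (add_nonneg (hv _ _ _) (hv _ _ _)) (markovKernel_pos _ _ _).le

theorem Oct.DivergenceLE.add {κ : ℝ} {v w : Oct ℝ} (hv : v.DivergenceLE κ)
    (hw : w.DivergenceLE κ) : (v + w).DivergenceLE κ := by
  refine ⟨fun a b e => ?_, ?_⟩
  · rw [get_add]
    exact add_nonneg (hv.1 _ _ _) (hw.1 _ _ _)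
  · have h : (v + w).divergence ≤ v.divergence + w.divergence := by
      simp only [divergence, ← sum_add_distrib]
      refine sum_le_sum fun a _ => sum_le_sum fun b _ => sum_le_sum fun e _ => ?_
      simp only [get_add]
      refine le_trans (le_of_eq ?_) (add_mul_log_div_le (hv.1 a b e)
        (marginal_mul_nonneg hv.1 a b e) (hw.1 a b e) (marginal_mul_nonneg hw.1 a b e)
        (marginal_mul_eq_zero hv.1) (marginal_mul_eq_zero hw.1))
      congr 3
      ring
    simp only [get_add, sum_add_distrib, mul_add]
    exact h.trans (add_le_add hv.2 hw.2)

theorem Oct.DivergenceLE.smul {κ r : ℝ} (hr : 0 ≤ r) {v : Oct ℝ} (hv : v.DivergenceLE κ) :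
    (r • v).DivergenceLE κ := by
  refine ⟨fun a b e => ?_, ?_⟩
  · rw [get_smul]
    exact mul_nonneg hr (hv.1 _ _ _)
  · have h : (r • v).divergence = r * v.divergence := by
      simp only [divergence, get_smul, mul_sum]
      refine sum_congr rfl fun a _ => sum_congr rfl fun b _ => sum_congr rfl fun e _ => ?_
      rw [← mul_mul_log_mul_div_mul, ← mul_add, mul_assoc r (_ + _)]
    rw [h]
    simp only [get_smul, ← mul_sum]
    calc r * v.divergence ≤ r * (κ * ∑ a, ∑ b, ∑ e, v.get a b e) :=
          mul_le_mul_of_nonneg_left hv.2 hr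
      _ = _ := by ring

theorem Oct.step_add (c : Bool) (v w : Oct ℝ) : (v + w).step c = v.step c + w.step c :=
  ext_get fun a b e => by
    simp only [get_step, get_add]
    split_ifs <;> ring

theorem Oct.step_smul (c : Bool) (r : ℝ) (v : Oct ℝ) : (r • v).step c = r • v.step c :=
  ext_get fun a b e => by
    simp only [get_step, get_smul]
    split_ifs <;> ring

theorem prependLaw_add (u : List Bool) (v w : Oct ℝ) :
    prependLaw u (v + w) = prependLaw u v + prependLaw u w := by
  induction u with
  | nil => rfl
  | cons c u ih =>
    change (1 / 2 : ℝ) • (prependLaw u (v + w)).step c =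
      (1 / 2 : ℝ) • (prependLaw u v).step c + (1 / 2 : ℝ) • (prependLaw u w).step c
    rw [ih, Oct.step_add]
    exact Oct.ext_get fun a b e => by simp only [Oct.get_add, Oct.get_smul]; ring

theorem prependLaw_smul (u : List Bool) (r : ℝ) (v : Oct ℝ) :
    prependLaw u (r • v) = r • prependLaw u v := by
  induction u with
  | nil => rfl
  | cons c u ih =>
    change (1 / 2 : ℝ) • (prependLaw u (r • v)).step c = r • (1 / 2 : ℝ) • (prependLaw u v).step c
    rw [ih, Oct.step_smul]
    exact Oct.ext_get fun a b e => by simp only [Oct.get_smul]; ring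

theorem prependLaw_map_cast (u : List Bool) (v : Oct ℕ) :
    prependLaw u (v.map Nat.cast) = (1 / 2 : ℝ) ^ u.length • (u.foldr Oct.step v).map Nat.cast := by
  induction u with
  | nil => exact Oct.ext_get fun a b e => by rw [Oct.get_smul]; simp [prependLaw]
  | cons c u ih =>
    change (1 / 2 : ℝ) • (prependLaw u (v.map Nat.cast)).step c = _
    have h : ∀ w : Oct ℕ, (w.step c).map (Nat.cast : ℕ → ℝ) = (w.map Nat.cast).step c := fun w => by
      cases c <;> simp [Oct.step, Oct.map]
    rw [ih, Oct.step_smul, List.foldr_cons, h, List.length_cons, pow_succ]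
    exact Oct.ext_get fun a b e => by simp only [Oct.get_smul]; ring

/-- The sum of the entries. -/
def Oct.total (v : Oct ℕ) : ℕ :=
  v.x0 + v.x1 + v.x2 + v.x3 + v.x4 + v.x5 + v.x6 + v.x7

theorem Oct.total_foldr_step (u : List Bool) (v : Oct ℕ) :
    (u.foldr step v).total = 2 ^ u.length * v.total := by
  induction u with
  | nil => simp
  | cons c u ih =>
    have h : ∀ w : Oct ℕ, (w.step c).total = 2 * w.total := fun w => by
      cases c <;> simp only [step, total] <;> ring
    rw [List.foldr_cons, h, ih, List.length_cons]
    ring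

theorem natCast_mul_log_div (j k : ℕ) (hjk : j ≤ k) {r : ℝ} (hr : 0 < r) :
    (j : ℝ) * Real.log (j / (k * (r / 64))) =
      j * Real.log j - j * Real.log k - j * Real.log r + 6 * j * Real.log 2 := by
  rcases Nat.eq_zero_or_pos j with rfl | hj
  · simp
  · have h1 : (0 : ℝ) < j := by exact_mod_cast hj
    have h2 : (0 : ℝ) < k := by exact_mod_cast hj.trans_le hjk
    have h3 : Real.log 64 = 6 * Real.log 2 := by
      rw [show (64 : ℝ) = 2 ^ 6 by norm_num, Real.log_pow]
      norm_num
    rw [Real.log_div h1.ne' (by positivity), Real.log_mul h2.ne' (by positivity),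
      Real.log_div hr.ne' (by norm_num), h3]
    ring

theorem Oct.divergenceLE_of_certified {s t : ℕ} {v : Oct ℕ} (h : v.certified s t = true)
    (hv : v.total = 2048) :
    (v.map (Nat.cast : ℕ → ℝ)).DivergenceLE
      (Real.log 2 * (767 / 2048 + ((s : ℝ) - t) / 128)) := by
  have hself : ∀ k : ℕ, k ^ k ≠ 0 := fun k => (Nat.pow_self_pos (n := k)).ne'
  have hself' : ∀ k : ℕ, (k : ℝ) ^ k ≠ 0 := fun k => by exact_mod_cast hself k
  have hpow : ∀ a k : ℕ, [NeZero a] → (a : ℝ) ^ k ≠ 0 := fun a k _ =>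
    pow_ne_zero k (Nat.cast_ne_zero.2 (NeZero.ne a))
  have h1 := Nat.le_of_ble_eq_true h
  have h2 : 0 < v.x0 ^ v.x0 * v.x1 ^ v.x1 * (v.x2 ^ v.x2 * v.x3 ^ v.x3) *
      (v.x4 ^ v.x4 * v.x5 ^ v.x5 * (v.x6 ^ v.x6 * v.x7 ^ v.x7)) * 2 ^ (12288 + 16 * t) := by
    refine Nat.pos_of_ne_zero ?_
    simp only [ne_eq, mul_eq_zero, hself, (Nat.two_pow_pos _).ne', or_self, not_false_eq_true]
  have h3 := Real.log_le_log (by exact_mod_cast h2) (Nat.cast_le (α := ℝ).2 h1)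
  simp only [Nat.cast_mul, Nat.cast_pow, Real.log_mul, Real.log_pow, ne_eq, mul_eq_zero, hself',
    hpow 50, hpow 14, hpow 26, hpow 38, hpow 2, not_false_eq_true, or_self] at h3
  have h4 : (v.x0 : ℝ) + v.x1 + v.x2 + v.x3 + v.x4 + v.x5 + v.x6 + v.x7 = 2048 := by
    exact_mod_cast hv
  refine ⟨fun a b e => ?_, ?_⟩
  · cases a <;> cases b <;> cases e <;> exact Nat.cast_nonneg _
  · have d0 := natCast_mul_log_div v.x0 (v.x0 + v.x1) (by omega) (r := 50) (by norm_num)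
    have d1 := natCast_mul_log_div v.x1 (v.x0 + v.x1) (by omega) (r := 14) (by norm_num)
    have d2 := natCast_mul_log_div v.x2 (v.x2 + v.x3) (by omega) (r := 26) (by norm_num)
    have d3 := natCast_mul_log_div v.x3 (v.x2 + v.x3) (by omega) (r := 38) (by norm_num)
    have d4 := natCast_mul_log_div v.x4 (v.x4 + v.x5) (by omega) (r := 38) (by norm_num)
    have d5 := natCast_mul_log_div v.x5 (v.x4 + v.x5) (by omega) (r := 26) (by norm_num)
    have d6 := natCast_mul_log_div v.x6 (v.x6 + v.x7) (by omega) (r := 14) (by norm_num)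
    have d7 := natCast_mul_log_div v.x7 (v.x6 + v.x7) (by omega) (r := 50) (by norm_num)
    simp only [divergence, Fintype.sum_bool, get, map, markovKernel]
    push_cast at h3 d0 d1 d2 d3 d4 d5 d6 d7 ⊢
    have h5 := congrArg (· * Real.log 2) h4
    have h6 : (v.x7 : ℝ) + v.x6 + (v.x5 + v.x4) + (v.x3 + v.x2 + (v.x1 + v.x0)) = 2048 := by
      linarith
    rw [d0, d1, d2, d3, d4, d5, d6, d7, h6]
    linarith

theorem certified_of_certifiedAll {k : ℕ} {u : List Bool} {v : Oct ℕ}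
    (h : certifiedAll k u v = true) {w : List Bool} (hw : w.length = k) :
    (w.foldr Oct.step v).certified (potential (w ++ u)) (potential (w ++ u).tail) = true := by
  have happ : ∀ (n : ℕ) (f : ℕ → Bool), applyEval n f = f n := fun n f => by cases n <;> rfl
  have hoct : ∀ (v : Oct ℕ) (f : Oct ℕ → Bool), v.applyEval f = f v := fun v f => by
    simp only [Oct.applyEval, happ]
  induction k generalizing u v w with
  | zero =>
    obtain rfl := List.length_eq_zero_iff.1 hw
    exact h
  | succ k ih =>
    obtain rfl | ⟨w, c, rfl⟩ := List.eq_nil_or_concat w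
    · simp at hw
    have hlen : w.length = k := by simpa using hw
    simp only [certifiedAll, hoct, Bool.and_eq_true] at h
    rw [List.concat_eq_append, List.foldr_append, List.append_assoc]
    cases c
    · exact ih h.1 hlen
    · exact ih h.2 hlen

theorem prefixIndex_takeD {k m : ℕ} (h : k ≤ m) (z : List Bool) :
    prefixIndex k (z.takeD m false) = prefixIndex k z := by
  induction k generalizing m z with
  | zero => rfl
  | succ k ih =>
    obtain ⟨m, rfl⟩ : ∃ j, m = j + 1 := ⟨m - 1, by omega⟩
    simp only [List.takeD, prefixIndex, List.headD_cons, List.tail_cons, ih (by omega : k ≤ m)]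

theorem firstLaw_eq_prependLaw (m : ℕ) (z : List Bool) :
    firstLaw z = prependLaw (z.takeD m false) (firstLaw (z.drop m)) := by
  induction m generalizing z with
  | zero => rfl
  | succ m ih =>
    have h : firstLaw z = (1 / 2 : ℝ) • (firstLaw z.tail).step (z.headD false) := by
      cases z with
      | nil =>
        refine Oct.ext_get fun a b e => ?_
        rw [Oct.get_smul, Oct.get_step]
        cases a <;> cases b <;> cases e <;> norm_num [firstLaw, prependLaw, Oct.get]
      | cons c z => rfl
    rw [h, ih z.tail, List.drop_tail]
    rfl

/-- The certified bound for the divergence of the law of the first three output bits. -/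
theorem divergence_firstLaw_le (z : List Bool) :
    (firstLaw z).divergence ≤
      Real.log 2 * (767 / 2048 + ((potential z : ℝ) - potential z.tail) / 128) := by
  set u := z.takeD 11 false with hu
  have hlen : u.length = 11 := List.takeD_length ..
  have h1 : potential u = potential z := by
    simp only [potential, hu, prefixIndex_takeD (by norm_num : 10 ≤ 11)]
  have h2 : potential u.tail = potential z.tail := by
    have : u.tail = z.tail.takeD 10 false := rfl
    simp only [potential, this, prefixIndex_takeD le_rfl]
  set κ := Real.log 2 * (767 / 2048 + ((potential z : ℝ) - potential z.tail) / 128) with hκ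
  have h3 : ∀ v : Oct ℕ, v.total = 1 → certifiedAll 11 [] v = true →
      (prependLaw u (v.map Nat.cast)).DivergenceLE κ := fun v hv h => by
    have h4 := certified_of_certifiedAll h hlen
    rw [List.append_nil, h1, h2] at h4
    rw [prependLaw_map_cast]
    refine (Oct.divergenceLE_of_certified h4 ?_).smul (by positivity)
    rw [Oct.total_foldr_step, hlen, hv]
    norm_num
  obtain ⟨c0, c1, c2, c3, c4, c5, c6, c7⟩ := certifiedAll_unit
  set T := firstLaw (z.drop 11) with hT
  have hT0 := firstLaw_nonneg (z.drop 11)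
  have h4 : T = T.x0 • Oct.map Nat.cast ⟨1, 0, 0, 0, 0, 0, 0, 0⟩ +
      (T.x1 • Oct.map Nat.cast ⟨0, 1, 0, 0, 0, 0, 0, 0⟩ +
      (T.x2 • Oct.map Nat.cast ⟨0, 0, 1, 0, 0, 0, 0, 0⟩ +
      (T.x3 • Oct.map Nat.cast ⟨0, 0, 0, 1, 0, 0, 0, 0⟩ +
      (T.x4 • Oct.map Nat.cast ⟨0, 0, 0, 0, 1, 0, 0, 0⟩ +
      (T.x5 • Oct.map Nat.cast ⟨0, 0, 0, 0, 0, 1, 0, 0⟩ +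
      (T.x6 • Oct.map Nat.cast ⟨0, 0, 0, 0, 0, 0, 1, 0⟩ +
      T.x7 • Oct.map Nat.cast ⟨0, 0, 0, 0, 0, 0, 0, 1⟩)))))) := by
    refine Oct.ext_get fun a b e => ?_
    simp only [Oct.get_add, Oct.get_smul]
    cases a <;> cases b <;> cases e <;> simp [Oct.get, Oct.map]
  have h5 : (firstLaw z).DivergenceLE κ := by
    rw [firstLaw_eq_prependLaw 11 z, ← hu, ← hT, h4]
    simp only [prependLaw_add, prependLaw_smul]
    exact ((h3 _ rfl c0).smul (hT0 false false false)).add <|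
      ((h3 _ rfl c1).smul (hT0 false false true)).add <|
      ((h3 _ rfl c2).smul (hT0 false true false)).add <|
      ((h3 _ rfl c3).smul (hT0 false true true)).add <|
      ((h3 _ rfl c4).smul (hT0 true false false)).add <|
      ((h3 _ rfl c5).smul (hT0 true false true)).add <|
      ((h3 _ rfl c6).smul (hT0 true true false)).add <|
      (h3 _ rfl c7).smul (hT0 true true true)
  simpa only [sum_firstLaw, mul_one] using h5.2

/-! ### The divergence of the output law -/

/-- The divergence of the output law, at deletion probability `1/2`, from the law with the same
first three letters and the transition probabilities `markovKernel`. -/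
noncomputable def outputDivergence (n : ℕ) (z : List Bool) : ℝ :=
  ∑ y ∈ listsUpTo n, delLaw (1 / 2) z y * Real.log (delLaw (1 / 2) z y /
    ((firstLaw z).get (y.getD 0 false) (y.getD 1 false) (y.getD 2 false) * markovWeight y))

theorem delLaw_half_nonneg (z y : List Bool) : 0 ≤ delLaw (1 / 2) z y :=
  delLaw_nonneg (by norm_num) (by norm_num) z y

theorem outputDivergence_cons_le (n : ℕ) (c : Bool) {z : List Bool} (hz : z.length ≤ n) :
    outputDivergence (n + 1) (c :: z) ≤
      1 / 2 * (outputDivergence n z + (firstLaw z).divergence) +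
        1 / 2 * outputDivergence (n + 1) z := by
  set T := firstLaw z with hT
  have hT0 : ∀ a b e, 0 ≤ T.get a b e := firstLaw_nonneg z
  have hR := markovWeight_pos
  have hw := delLaw_half_nonneg z
  have hwT : ∀ y, T.get (y.getD 0 false) (y.getD 1 false) (y.getD 2 false) = 0 →
      delLaw (1 / 2) z y = 0 := fun y h =>
    le_antisymm ((delLaw_le_firstLaw z y).trans_eq h) (hw y)
  set M : List Bool → ℝ := fun y =>
    (T.get (y.getD 0 false) (y.getD 1 false) false +
      T.get (y.getD 0 false) (y.getD 1 false) true) *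
      markovKernel (y.getD 0 false) (y.getD 1 false) (y.getD 2 false) with hM
  have hM0 : ∀ y, 0 ≤ M y := fun y => Oct.marginal_mul_nonneg hT0 _ _ _
  have hMT : ∀ y, M y = 0 → T.get (y.getD 0 false) (y.getD 1 false) (y.getD 2 false) = 0 :=
    fun y h => Oct.marginal_mul_eq_zero hT0 h
  have h1 : ∑ y ∈ listsUpTo n,
      delLaw (1 / 2) z y * Real.log (delLaw (1 / 2) z y / (M y * markovWeight y)) =
      outputDivergence n z + T.divergence := by
    have h2 := sum_delLaw_mul_first n hz fun a b e =>
      Real.log (T.get a b e / ((T.get a b false + T.get a b true) * markovKernel a b e))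
    rw [Oct.divergence, hT, ← h2, outputDivergence, ← sum_add_distrib]
    refine sum_congr rfl fun y _ => ?_
    rw [← mul_add]
    rcases (hw y).eq_or_lt with h3 | h3
    · rw [← h3, zero_mul, zero_mul]
    · have h4 : T.get (y.getD 0 false) (y.getD 1 false) (y.getD 2 false) ≠ 0 :=
        fun h => h3.ne' (hwT y h)
      have h5 : M y ≠ 0 := fun h => h4 (hMT y h)
      have h6 := (hR y).ne'
      congr 1
      rw [← hT, ← Real.log_mul (div_ne_zero h3.ne' (mul_ne_zero h4 h6)) (div_ne_zero h4 h5)]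
      congr 1
      change _ = _ * (_ / M y)
      field_simp
  have hB : ∀ y, 0 ≤ 1 / 2 * (T.get (y.getD 0 false) (y.getD 1 false) (y.getD 2 false) *
      markovWeight y) := fun y => mul_nonneg (by norm_num) (mul_nonneg (hT0 _ _ _) (hR y).le)
  have hB0 : ∀ y, 1 / 2 * (T.get (y.getD 0 false) (y.getD 1 false) (y.getD 2 false) *
      markovWeight y) = 0 → 1 / 2 * delLaw (1 / 2) z y = 0 := fun y h => by
    rw [hwT y (by simpa [(hR y).ne'] using h), mul_zero]
  have hw2 : ∀ y, 0 ≤ 1 / 2 * delLaw (1 / 2) z y := fun y => mul_nonneg (by norm_num) (hw y)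
  have hA : ∀ y, 0 ≤ 1 / 2 * (M y * markovWeight y) := fun y =>
    mul_nonneg (by norm_num) (mul_nonneg (hM0 y) (hR y).le)
  have hA0 : ∀ y, 1 / 2 * (M y * markovWeight y) = 0 → 1 / 2 * delLaw (1 / 2) z y = 0 :=
    fun y h => by
      rw [hwT y (hMT y (by simpa [(hR y).ne'] using h)), mul_zero]
  rw [← h1]
  unfold outputDivergence
  rw [sum_listsUpTo_succ, sum_listsUpTo_succ]
  have hnil : delLaw (1 / 2) (c :: z) [] * Real.log (delLaw (1 / 2) (c :: z) [] /
      ((firstLaw (c :: z)).get false false false * markovWeight [])) ≤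
      1 / 2 * (delLaw (1 / 2) z [] * Real.log (delLaw (1 / 2) z [] /
        (T.get false false false * markovWeight []))) := by
    have h2 := add_mul_log_div_le (a := 0) (le_refl 0) (A := 1 / 2 * (if false = c then
      T.get false false false + T.get false false true else 0)) ?_ (hw2 []) (hB [])
      (fun _ => rfl) (hB0 [])
    · simp only [mul_mul_log_mul_div_mul, zero_add, zero_mul, List.getD_nil, markovWeight,
        mul_one] at h2
      rw [get_firstLaw_cons, ← hT, delLaw, markovWeight, mul_one, mul_one]
      exact h2
    · have := hT0 false false false
      have := hT0 false false true
      split_ifs <;> positivity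
  have hcons : ∀ y, delLaw (1 / 2) (c :: z) (c :: y) * Real.log (delLaw (1 / 2) (c :: z) (c :: y) /
      ((firstLaw (c :: z)).get c (y.getD 0 false) (y.getD 1 false) * markovWeight (c :: y))) ≤
      1 / 2 * (delLaw (1 / 2) z y * Real.log (delLaw (1 / 2) z y / (M y * markovWeight y))) +
      1 / 2 * (delLaw (1 / 2) z (c :: y) * Real.log (delLaw (1 / 2) z (c :: y) /
        (T.get c (y.getD 0 false) (y.getD 1 false) * markovWeight (c :: y)))) := fun y => by
    have h2 := add_mul_log_div_le (hw2 y) (hA y) (hw2 (c :: y)) (hB (c :: y)) (hA0 y)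
      (hB0 (c :: y))
    simp only [mul_mul_log_mul_div_mul, List.getD_cons_zero, List.getD_cons_succ] at h2
    refine le_trans (le_of_eq ?_) h2
    rw [get_firstLaw_cons, ← hT, if_pos rfl, delLaw, if_pos rfl, hM, markovWeight]
    norm_num only [mul_assoc]
    congr 3
    ring
  have hne : ∀ b y, b ≠ c →
      delLaw (1 / 2) (c :: z) (b :: y) * Real.log (delLaw (1 / 2) (c :: z) (b :: y) /
      ((firstLaw (c :: z)).get b (y.getD 0 false) (y.getD 1 false) * markovWeight (b :: y))) ≤
      1 / 2 * (delLaw (1 / 2) z (b :: y) * Real.log (delLaw (1 / 2) z (b :: y) /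
        (T.get b (y.getD 0 false) (y.getD 1 false) * markovWeight (b :: y)))) := fun b y hb => by
    refine le_of_eq ?_
    rw [get_firstLaw_cons, ← hT, if_neg hb, delLaw, if_neg hb, ← mul_mul_log_mul_div_mul]
    norm_num only [mul_zero, zero_add, mul_assoc]
  have s1 := sum_le_sum fun y (_ : y ∈ listsUpTo n) => hcons y
  have s2 := sum_le_sum fun y (_ : y ∈ listsUpTo n) => hne (!c) y (by simp)
  simp only [sum_add_distrib, ← mul_sum] at s1 s2
  simp only [List.getD_nil, List.getD_cons_zero, List.getD_cons_succ, Fintype.sum_bool,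
    ← hT] at hnil s1 s2 ⊢
  cases c <;> simp only [Bool.not_true, Bool.not_false] at s2 <;> linarith

theorem outputDivergence_le {n : ℕ} {z : List Bool} (hz : z.length ≤ n) :
    outputDivergence n z ≤ 1 / 2 * (Real.log 2 *
      (767 / 2048 * z.length + ((potential z.tail : ℝ) - potential []) / 128)) := by
  induction z generalizing n with
  | nil =>
    cases n <;> simp [outputDivergence, sum_listsUpTo_zero, sum_listsUpTo_succ, delLaw, firstLaw,
      prependLaw, Oct.get, markovWeight]
  | cons c z ih =>
    obtain ⟨n, rfl⟩ : ∃ m, n = m + 1 := ⟨n - 1, by simp at hz; omega⟩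
    have hz : z.length ≤ n := by simpa using hz
    have h1 := outputDivergence_cons_le n c hz
    have h2 := ih hz
    have h3 := ih (hz.trans n.le_succ)
    have h4 := divergence_firstLaw_le z
    rw [List.length_cons, List.tail_cons]
    push_cast
    linarith

theorem sum_delLaw_half_mul_log_le {n : ℕ} {z : List Bool} (hz : z.length ≤ n) :
    ∑ y ∈ listsUpTo n, delLaw (1 / 2) z y * Real.log (delLaw (1 / 2) z y / markovWeight y) ≤
      1 / 2 * (Real.log 2 * (767 / 2048 * z.length + 2)) := by
  have hlog : 0 < Real.log 2 := Real.log_pos one_lt_two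
  have h1 : (potential z.tail : ℝ) ≤ 256 := by
    exact_mod_cast (Nat.mod_lt _ (by norm_num)).le
  have h2 : (0 : ℝ) ≤ potential [] := Nat.cast_nonneg _
  have h3 : (767 / 2048 * z.length + ((potential z.tail : ℝ) - potential []) / 128) ≤
      767 / 2048 * z.length + 2 := by linarith
  refine le_trans ?_ ((outputDivergence_le hz).trans
    (mul_le_mul_of_nonneg_left (mul_le_mul_of_nonneg_left h3 hlog.le) (by norm_num)))
  refine sum_le_sum fun y _ => mul_le_mul_of_nonneg_left ?_ (delLaw_half_nonneg z y)
  have hR := markovWeight_pos y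
  rcases (delLaw_half_nonneg z y).eq_or_lt with h | h
  · rw [← h, zero_div, zero_div]
  · have h4 := h.trans_le (delLaw_le_firstLaw z y)
    refine Real.log_le_log (div_pos h hR) (div_le_div_of_nonneg_left h.le (mul_pos h4 hR) ?_)
    exact mul_le_of_le_one_left hR.le (firstLaw_le_one _ _ _ _)

theorem sum_delLaw_mul_log_le {d : ℝ} (hd₁ : 1 / 2 ≤ d) (hd₂ : d ≤ 1) {n : ℕ} {x : List Bool}
    (hx : x.length ≤ n) :
    ∑ y ∈ listsUpTo n, delLaw d x y * Real.log (delLaw d x y / markovWeight y) ≤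
      Real.log 2 * (767 / 2048 * ((1 - d) * x.length) + 1) := by
  have hp0 : 0 ≤ 2 * (1 - d) := by linarith
  have hp1 : 2 * (1 - d) ≤ 1 := by linarith
  have h1 : ∀ y, delLaw d x y = sublistMean (2 * (1 - d)) x fun z => delLaw (1 / 2) z y := fun y => by
    rw [sublistMean_delLaw]
    congr 1
    ring
  calc ∑ y ∈ listsUpTo n, delLaw d x y * Real.log (delLaw d x y / markovWeight y)
      ≤ ∑ y ∈ listsUpTo n, sublistMean (2 * (1 - d)) x fun z =>
          delLaw (1 / 2) z y * Real.log (delLaw (1 / 2) z y / markovWeight y) :=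
        sum_le_sum fun y _ => by
          rw [h1]
          exact sublistMean_convexOn hp0 hp1 (convexOn_mul_log_div (markovWeight_pos y)) x
            fun z => delLaw_half_nonneg z y
    _ ≤ sublistMean (2 * (1 - d)) x fun z =>
          1 / 2 * (Real.log 2 * (767 / 2048 * z.length + 2)) := by
        rw [← sublistMean_sum]
        exact sublistMean_mono hp0 hp1 fun z hz => sum_delLaw_half_mul_log_le (hz.trans hx)
    _ = _ := by
        simp only [sublistMean_const_mul, sublistMean_add, sublistMean_const, sublistMean_length]
        ring

/-! ### The capacity bound -/

theorem Cdel_le {d : ℝ} (hd₁ : 1 / 2 ≤ d) (hd₂ : d ≤ 1) (n : ℕ) :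
    Cdel n d ≤ Real.log (8 * (n + 1)) / Real.log 2 + (767 / 2048 * ((1 - d) * n) + 1) := by
  have hlog : 0 < Real.log 2 := Real.log_pos one_lt_two
  have hn : (0 : ℝ) < 8 * (n + 1) := by positivity
  refine csSup_le ?_ ?_
  · refine ⟨_, fun x => if x = fun _ => false then 1 else 0, ⟨fun x => ?_, ?_⟩, rfl⟩
    · dsimp only
      split_ifs <;> norm_num
    · simp
  · rintro _ ⟨p, hp, rfl⟩
    have hlen : ∀ x : Fin n → Bool, (List.ofFn x).length = n := fun x => List.length_ofFn
    have h1 := MI_le hp (W := Wdel n d) (Ys := listsUpTo n)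
      (fun x y => by
        rw [Wdel_eq_delLaw]
        exact delLaw_nonneg (by linarith) hd₂ _ _)
      (fun x => by
        simp only [Wdel_eq_delLaw]
        exact sum_delLaw d (hlen x).le)
      (Q := fun y => markovWeight y / (8 * (n + 1))) (fun y => div_pos (markovWeight_pos y) hn)
      (by
        have h2 := sum_markovWeight_mul_le n (g := fun _ _ _ => 1) fun _ _ _ => zero_le_one
        rw [← sum_div, div_le_one hn]
        simp only [mul_one, sum_const, card_univ, Fintype.card_bool, nsmul_eq_mul] at h2
        norm_num at h2
        linarith)
      (C := Real.log (8 * (n + 1)) + Real.log 2 * (767 / 2048 * ((1 - d) * n) + 1))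
      fun x => by
        simp only [Wdel_eq_delLaw]
        have h3 := sum_delLaw_mul_log_le hd₁ hd₂ (hlen x).le
        rw [hlen] at h3
        refine le_trans (le_of_eq ?_) (add_le_add_right h3 _)
        have h4 := congrArg (Real.log (8 * ((n : ℝ) + 1)) * ·) (sum_delLaw d (hlen x).le)
        simp only [mul_one, mul_sum] at h4
        rw [← h4, ← sum_add_distrib]
        refine sum_congr rfl fun y _ => ?_
        rw [mul_comm (Real.log (8 * _)), ← mul_add]
        rcases eq_or_ne (delLaw d (List.ofFn x) y) 0 with h | h
        · rw [h, zero_mul, zero_mul]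
        · rw [div_div_eq_mul_div, mul_comm _ (8 * _), mul_div_assoc, Real.log_mul hn.ne'
            (div_ne_zero h (markovWeight_pos y).ne')]
    rwa [add_div, mul_div_cancel_left₀ _ hlog.ne'] at h1

theorem tendsto_log_mul_succ_div : Filter.Tendsto
    (fun n : ℕ => Real.log (8 * ((n : ℝ) + 1)) / n) Filter.atTop (nhds 0) := by
  have h1 : Filter.Tendsto (fun n : ℕ => Real.log (n : ℝ) / n) Filter.atTop (nhds 0) :=
    (Real.isLittleO_log_id_atTop.tendsto_div_nhds_zero).comp tendsto_natCast_atTop_atTop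
  have h2 : Filter.Tendsto (fun n : ℕ => Real.log 16 / (n : ℝ)) Filter.atTop (nhds 0) :=
    tendsto_const_div_atTop_nhds_zero_nat _
  have h3 := h2.add h1
  rw [add_zero] at h3
  refine squeeze_zero' (Filter.Eventually.of_forall fun n => ?_) ?_ h3
  · exact div_nonneg (Real.log_nonneg (by linarith [n.cast_nonneg (α := ℝ)])) n.cast_nonneg
  · filter_upwards [Filter.eventually_ge_atTop 1] with n hn
    have hn : (1 : ℝ) ≤ n := by exact_mod_cast hn
    rw [← add_div, ← Real.log_mul (by norm_num) (by positivity)]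
    exact div_le_div_of_nonneg_right (Real.log_le_log (by positivity) (by linarith)) (by positivity)

/-- For every `0.68 ≤ d < 1`, the capacity of the binary deletion
channel satisfies `C(BDC_d) ≤ 0.3747 · (1 − d)`: for every real `L`, if
`C_n(d)/n → L` as `n → ∞`, then `L ≤ 0.3747 · (1 − d)`. -/
theorem bdc_upper_bound (d : ℝ) (hd₁ : 0.68 ≤ d) (hd₂ : d < 1) (L : ℝ)
    (hL : Filter.Tendsto (fun n : ℕ => Cdel n d / n) Filter.atTop (nhds L)) :
    L ≤ 0.3747 * (1 - d) := by
  have h1 : Filter.Tendsto (fun n : ℕ => Real.log (8 * ((n : ℝ) + 1)) / n / Real.log 2 +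
      (767 / 2048 * (1 - d) + 1 / n)) Filter.atTop
      (nhds (0 / Real.log 2 + (767 / 2048 * (1 - d) + 0))) :=
    (tendsto_log_mul_succ_div.div_const _).add
      (tendsto_const_nhds.add (tendsto_const_div_atTop_nhds_zero_nat _))
  rw [zero_div, zero_add, add_zero] at h1
  have h2 : L ≤ 767 / 2048 * (1 - d) := by
    refine le_of_tendsto_of_tendsto hL h1 ?_
    filter_upwards [Filter.eventually_gt_atTop 0] with n hn
    have hn : (0 : ℝ) < n := by exact_mod_cast hn
    refine (div_le_div_of_nonneg_right (Cdel_le (by linarith) hd₂.le n) hn.le).trans (le_of_eq ?_)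
    field_simp
  linarith
end

section
/- Let λ ∈ (0,1] and d' ∈ [0,1), and set d = λ·d' + 1 − λ. Then C(BDC_d)/(1−d) ≤ C(BDC_{d'})/(1−d'). Formally: for all reals L and L', if C_n(d)/n → L and C_n(d')/n → L' as n → ∞, then L/(1−d) ≤ L'/(1−d'). -/
open Finset

/-! ### Mutual information of an input distribution and a channel -/

/-- The log-sum inequality. -/
theorem sum_mul_log_div_sum_le {ι : Type*} (s : Finset ι) (a b : ι → ℝ)
    (ha : ∀ i ∈ s, 0 ≤ a i) (hb : ∀ i ∈ s, 0 ≤ b i) (hab : ∀ i ∈ s, b i = 0 → a i = 0) :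
    (∑ i ∈ s, a i) * Real.log ((∑ i ∈ s, a i) / ∑ i ∈ s, b i) ≤
      ∑ i ∈ s, a i * Real.log (a i / b i) := by
  rcases (sum_nonneg ha).eq_or_lt with h0 | hA
  · have h := (sum_eq_zero_iff_of_nonneg ha).1 h0.symm
    rw [← h0, zero_mul, sum_eq_zero fun i hi => by rw [h i hi, zero_mul]]
  have hB : 0 < ∑ i ∈ s, b i := by
    refine (sum_nonneg hb).lt_of_ne fun h0 => hA.ne' ?_
    have h := (sum_eq_zero_iff_of_nonneg hb).1 h0.symm
    exact sum_eq_zero fun i hi => hab i hi (h i hi)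
  set c := (∑ i ∈ s, a i) / ∑ i ∈ s, b i with hc
  have hc0 : 0 < c := div_pos hA hB
  have key : ∀ i ∈ s, a i * Real.log c + (a i - b i * c) ≤ a i * Real.log (a i / b i) := by
    intro i hi
    rcases (ha i hi).eq_or_lt with h | hai
    · rw [← h]
      have := mul_nonneg (hb i hi) hc0.le
      simpa using this
    · have hbi : 0 < b i := (hb i hi).lt_of_ne fun h => hai.ne' (hab i hi h.symm)
      have h1 := Real.one_sub_inv_le_log_of_pos (x := a i / b i / c) (by positivity)
      rw [Real.log_div (by positivity) hc0.ne'] at h1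
      have h2 := mul_le_mul_of_nonneg_left h1 hai.le
      have h3 : a i * (1 - (a i / b i / c)⁻¹) = a i - b i * c := by
        field_simp
      linarith
  have hsum := sum_le_sum key
  rw [sum_add_distrib, sum_sub_distrib, ← sum_mul, ← sum_mul, hc, mul_div_cancel₀ _ hB.ne'] at hsum
  simpa using hsum

theorem MI_mul_eq {α β : Type*} [Fintype α] [DecidableEq β] (p : α → ℝ) (W : α → β → ℝ)
    (Ys : Finset β) (hW : ∀ x, ∑ y ∈ Ys, W x y = 1) :
    MI (fun x y => p x * W x y) Ys =
      ∑ x, p x * ∑ y ∈ Ys, W x y * Real.logb 2 (W x y / ∑ x', p x' * W x' y) := by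
  unfold MI
  refine sum_congr rfl fun x _ => ?_
  rw [mul_sum]
  refine sum_congr rfl fun y _ => ?_
  rw [← mul_sum, hW, mul_one]
  by_cases hp : p x = 0
  · simp [hp]
  · rw [mul_div_mul_left _ _ hp, mul_assoc]

theorem MI_mul_le {α β : Type*} [Fintype α] [DecidableEq β] (p : α → ℝ) (W : α → β → ℝ)
    (Ys : Finset β) (hp : ∀ x, 0 ≤ p x) (hW0 : ∀ x y, 0 ≤ W x y)
    (hW : ∀ x, ∑ y ∈ Ys, W x y = 1) :
    MI (fun x y => p x * W x y) Ys ≤ Fintype.card α / Real.log 2 := by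
  have hlog : 0 < Real.log 2 := Real.log_pos one_lt_two
  rw [MI_mul_eq p W Ys hW]
  have key : ∀ x, p x * ∑ y ∈ Ys, W x y * Real.logb 2 (W x y / ∑ x', p x' * W x' y) ≤
      1 / Real.log 2 := by
    intro x
    rw [← hW x, mul_sum, sum_div]
    refine sum_le_sum fun y _ => ?_
    rcases (hp x).eq_or_lt with h | hpx
    · rw [← h, zero_mul]
      exact div_nonneg (hW0 x y) hlog.le
    rcases (hW0 x y).eq_or_lt with h | hWx
    · simp [← h]
    have hr : p x * W x y ≤ ∑ x', p x' * W x' y :=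
      single_le_sum (f := fun x' => p x' * W x' y)
        (fun i _ => mul_nonneg (hp i) (hW0 i y)) (mem_univ x)
    have hr0 := (mul_pos hpx hWx).trans_le hr
    rw [Real.logb, mul_div_assoc', mul_div_assoc']
    refine div_le_div_of_nonneg_right ?_ hlog.le
    have h1 : Real.log (W x y / ∑ x', p x' * W x' y) ≤ 1 / p x := by
      refine (Real.log_le_self (by positivity)).trans ?_
      rw [div_le_div_iff₀ hr0 hpx]
      linarith
    calc p x * (W x y * Real.log (W x y / ∑ x', p x' * W x' y))
        ≤ p x * (W x y * (1 / p x)) := by gcongr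
      _ = W x y := by field_simp
  refine (sum_le_sum fun x _ => key x).trans_eq ?_
  rw [sum_const, card_univ, nsmul_eq_mul, mul_one_div]

/-- Mutual information is convex in the channel. -/
theorem MI_mul_sum_le {ι α β : Type*} [Fintype ι] [Fintype α] [DecidableEq β] (p : α → ℝ)
    (w : ι → ℝ) (W : ι → α → β → ℝ) (Ys : Finset β) (hp : ∀ x, 0 ≤ p x) (hw : IsDist w)
    (hW0 : ∀ i x y, 0 ≤ W i x y) (hW : ∀ i x, ∑ y ∈ Ys, W i x y = 1) :
    MI (fun x y => p x * ∑ i, w i * W i x y) Ys ≤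
      ∑ i, w i * MI (fun x y => p x * W i x y) Ys := by
  have hlog : 0 < Real.log 2 := Real.log_pos one_lt_two
  have hmix : ∀ x, ∑ y ∈ Ys, ∑ i, w i * W i x y = 1 := by
    intro x
    rw [sum_comm]
    simp_rw [← mul_sum, hW, mul_one]
    exact hw.2
  rw [MI_mul_eq p _ Ys hmix]
  simp_rw [fun i => MI_mul_eq p (W i) Ys (hW i), mul_sum]
  refine (sum_le_sum fun x _ => ?_).trans_eq sum_comm
  refine (sum_le_sum fun y _ => ?_).trans_eq sum_comm
  rcases (hp x).eq_or_lt with h | hpx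
  · simp [← h]
  have hr : ∑ x', ∑ i, p x' * (w i * W i x' y) = ∑ i, w i * ∑ x', p x' * W i x' y := by
    rw [sum_comm]
    refine sum_congr rfl fun i _ => ?_
    rw [mul_sum]
    exact sum_congr rfl fun x' _ => by ring
  have hterm : ∀ i, w i * (p x * (W i x y * Real.logb 2 (W i x y / ∑ x', p x' * W i x' y))) =
      p x / Real.log 2 * ((w i * W i x y) *
        Real.log ((w i * W i x y) / (w i * ∑ x', p x' * W i x' y))) := by
    intro i
    by_cases hwi : w i = 0
    · simp [hwi]
    · rw [mul_div_mul_left _ _ hwi, Real.logb]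
      ring
  rw [hr, sum_congr rfl fun i _ => hterm i, ← mul_sum, Real.logb]
  have hls := sum_mul_log_div_sum_le univ (fun i => w i * W i x y)
    (fun i => w i * ∑ x', p x' * W i x' y)
    (fun i _ => mul_nonneg (hw.1 i) (hW0 i x y))
    (fun i _ => mul_nonneg (hw.1 i) (sum_nonneg fun x' _ => mul_nonneg (hp x') (hW0 i x' y)))
    (fun i _ h => by
      rcases mul_eq_zero.1 h with h | h
      · simp [h]
      · have := (sum_eq_zero_iff_of_nonneg (f := fun x' => p x' * W i x' y)
          fun x' _ => mul_nonneg (hp x') (hW0 i x' y)).1 h x (mem_univ x)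
        simp [(mul_eq_zero.1 this).resolve_left hpx.ne'])
  calc _ = p x / Real.log 2 * ((∑ i, w i * W i x y) *
        Real.log ((∑ i, w i * W i x y) / ∑ i, w i * ∑ x', p x' * W i x' y)) := by ring
    _ ≤ _ := mul_le_mul_of_nonneg_left hls (by positivity)

/-- The image of a distribution `p` under a map `g`. -/
noncomputable def pushDist {α γ : Type*} [Fintype α] [DecidableEq γ] (g : α → γ) (p : α → ℝ) :
    γ → ℝ :=
  fun z => ∑ x with g x = z, p x

theorem sum_pushDist_mul {α γ : Type*} [Fintype α] [Fintype γ] [DecidableEq γ] (g : α → γ)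
    (p : α → ℝ) (F : γ → ℝ) : ∑ z, pushDist g p z * F z = ∑ x, p x * F (g x) := by
  rw [← sum_fiberwise univ g]
  refine sum_congr rfl fun z _ => ?_
  rw [pushDist, sum_mul]
  exact sum_congr rfl fun x hx => by rw [(mem_filter.1 hx).2]

theorem IsDist.pushDist {α γ : Type*} [Fintype α] [Fintype γ] [DecidableEq γ] (g : α → γ)
    {p : α → ℝ} (hp : IsDist p) : IsDist (pushDist g p) := by
  refine ⟨fun z => sum_nonneg fun x _ => hp.1 x, ?_⟩
  have := sum_pushDist_mul g p fun _ => 1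
  simpa [hp.2] using this

theorem MI_comp_eq {α β γ : Type*} [Fintype α] [Fintype γ] [DecidableEq β] [DecidableEq γ]
    (g : α → γ) (p : α → ℝ) (V : γ → β → ℝ) (Ys : Finset β) (hV : ∀ z, ∑ y ∈ Ys, V z y = 1) :
    MI (fun x y => p x * V (g x) y) Ys = MI (fun z y => pushDist g p z * V z y) Ys := by
  rw [MI_mul_eq p (fun x => V (g x)) Ys fun x => hV (g x), MI_mul_eq _ V Ys hV,
    sum_pushDist_mul]
  simp_rw [fun y => sum_pushDist_mul g p fun z => V z y]

theorem MI_eq_of_subset {α β : Type*} [Fintype α] [DecidableEq β] (q : α → β → ℝ)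
    {Ys Zs : Finset β} (h : Ys ⊆ Zs) (hq : ∀ x, ∀ y ∉ Ys, q x y = 0) : MI q Zs = MI q Ys := by
  unfold MI
  refine sum_congr rfl fun x _ => ?_
  rw [← sum_subset h fun y _ hy => hq x y hy]
  refine (sum_subset h fun y _ hy => ?_).symm
  rw [hq x y hy, zero_mul]

theorem listsUpTo_mono {k n : ℕ} (h : k ≤ n) : listsUpTo k ⊆ listsUpTo n :=
  fun _ hy => mem_listsUpTo.2 ((mem_listsUpTo.1 hy).trans h)

theorem delOutput_mem_listsUpTo {n : ℕ} (x : Fin n → Bool) (S : Finset (Fin n)) :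
    delOutput x S ∈ listsUpTo n := by
  rw [mem_listsUpTo, delOutput, List.length_map, length_sort]
  simpa using card_le_univ S

theorem delOutput_map {k n : ℕ} (e : Fin k ↪o Fin n) (x : Fin n → Bool) (T : Finset (Fin k)) :
    delOutput x (T.map e.toEmbedding) = delOutput (x ∘ e) T := by
  rw [delOutput, delOutput, ← StrictMonoOn.map_finsetSort _ _ (e.strictMono.strictMonoOn _),
    List.map_map]
  rfl

theorem Wdel_nonneg {n : ℕ} {d : ℝ} (hd0 : 0 ≤ d) (hd1 : d ≤ 1) (x : Fin n → Bool)
    (y : List Bool) : 0 ≤ Wdel n d x y := by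
  have := sub_nonneg.2 hd1
  refine sum_nonneg fun S _ => ?_
  split_ifs <;> positivity

theorem Wdel_eq_zero {n : ℕ} (d : ℝ) (x : Fin n → Bool) {y : List Bool}
    (hy : y ∉ listsUpTo n) : Wdel n d x y = 0 :=
  sum_eq_zero fun S _ => if_neg fun h : delOutput x S = y => hy (h ▸ delOutput_mem_listsUpTo x S)

theorem sum_Wdel {n m : ℕ} (h : n ≤ m) (d : ℝ) (x : Fin n → Bool) :
    ∑ y ∈ listsUpTo m, Wdel n d x y = 1 := by
  unfold Wdel
  rw [sum_comm]
  have : ∀ S : Finset (Fin n), (∑ y ∈ listsUpTo m,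
      if delOutput x S = y then (1 - d) ^ S.card * d ^ (n - S.card) else 0) =
      (1 - d) ^ S.card * d ^ (n - S.card) := fun S => by
    rw [sum_ite_eq, if_pos (listsUpTo_mono h (delOutput_mem_listsUpTo x S))]
  rw [sum_congr rfl fun S _ => this S, Fin.sum_pow_mul_eq_add_pow]
  simp

theorem Wdel_card_comp {n : ℕ} (d : ℝ) (x : Fin n → Bool) (A : Finset (Fin n)) (y : List Bool) :
    Wdel A.card d (x ∘ A.orderEmbOfFin rfl) y =
      ∑ S ∈ A.powerset,
        if delOutput x S = y then (1 - d) ^ S.card * d ^ (A.card - S.card) else 0 := by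
  unfold Wdel
  refine sum_bij (fun T _ => T.map (A.orderEmbOfFin rfl).toEmbedding) ?_ ?_ ?_ ?_
  · intro T _
    rw [mem_powerset]
    exact (map_subset_map.2 (subset_univ T)).trans (map_orderEmbOfFin_univ A rfl).subset
  · intro T _ T' _ h
    exact map_injective _ h
  · intro S hS
    rw [mem_powerset, ← map_orderEmbOfFin_univ A rfl, subset_map_iff] at hS
    obtain ⟨T, -, rfl⟩ := hS
    exact ⟨T, mem_univ T, rfl⟩
  · intro T _
    rw [delOutput_map, card_map]

theorem sum_superset_pow {n : ℕ} (lam d : ℝ) (S : Finset (Fin n)) :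
    (∑ A : Finset (Fin n), if S ⊆ A then
      lam ^ A.card * (1 - lam) ^ (n - A.card) * ((1 - d) ^ S.card * d ^ (A.card - S.card)) else 0) =
      (lam * (1 - d)) ^ S.card * (lam * d + 1 - lam) ^ (n - S.card) := by
  have hc : Sᶜ.card = n - S.card := by rw [card_compl, Fintype.card_fin]
  rw [← sum_filter, ← hc, add_sub_assoc, ← sum_pow_mul_eq_add_pow, mul_sum]
  refine sum_nbij' (fun A => A \ S) (fun B => S ∪ B) ?_ ?_ ?_ ?_ ?_
  · intro A _
    rw [mem_powerset, sdiff_eq_inter_compl]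
    exact inter_subset_right
  · intro B _
    simp
  · intro A hA
    exact union_sdiff_of_subset (mem_filter.1 hA).2
  · intro B hB
    refine union_sdiff_cancel_left ?_
    exact disjoint_left.2 fun i hi hiB => mem_compl.1 (mem_powerset.1 hB hiB) hi
  · intro A hA
    have hSA := (mem_filter.1 hA).2
    have h1 := card_le_card hSA
    rw [card_sdiff_of_subset hSA, hc]
    have h2 : n - S.card - (A.card - S.card) = n - A.card := by omega
    obtain ⟨j, hj⟩ := Nat.exists_eq_add_of_le h1
    rw [h2, hj, Nat.add_sub_cancel_left, mul_pow]
    ring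

/-- The deletion channel as a mixture: each position is independently offered to a deletion
channel with parameter `d` with probability `lam`, and deleted otherwise. -/
theorem Wdel_eq_sum (n : ℕ) (lam d : ℝ) (x : Fin n → Bool) (y : List Bool) :
    Wdel n (lam * d + 1 - lam) x y =
      ∑ A : Finset (Fin n), lam ^ A.card * (1 - lam) ^ (n - A.card) *
        Wdel A.card d (x ∘ A.orderEmbOfFin rfl) y := by
  have hA : ∀ A : Finset (Fin n), lam ^ A.card * (1 - lam) ^ (n - A.card) *
        Wdel A.card d (x ∘ A.orderEmbOfFin rfl) y =
      ∑ S : Finset (Fin n), if delOutput x S = y then if S ⊆ A then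
        lam ^ A.card * (1 - lam) ^ (n - A.card) *
          ((1 - d) ^ S.card * d ^ (A.card - S.card)) else 0 else 0 := by
    intro A
    rw [Wdel_card_comp, mul_sum, ← filter_subset_univ, sum_filter]
    refine sum_congr rfl fun S _ => ?_
    split_ifs <;> simp
  rw [sum_congr rfl fun A _ => hA A, sum_comm, Wdel]
  refine sum_congr rfl fun S _ => ?_
  split_ifs with h
  · rw [sum_superset_pow]
    ring
  · simp

theorem MI_Wdel_le_Cdel {n : ℕ} {d : ℝ} (hd0 : 0 ≤ d) (hd1 : d ≤ 1) {p : (Fin n → Bool) → ℝ}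
    (hp : IsDist p) : MI (fun x y => p x * Wdel n d x y) (listsUpTo n) ≤ Cdel n d := by
  refine le_csSup ⟨Fintype.card (Fin n → Bool) / Real.log 2, ?_⟩ ⟨p, hp, rfl⟩
  rintro r ⟨p', hp', rfl⟩
  exact MI_mul_le p' _ _ hp'.1 (Wdel_nonneg hd0 hd1) (sum_Wdel le_rfl d)

theorem isDist_pow_mul_pow (n : ℕ) {lam : ℝ} (h0 : 0 ≤ lam) (h1 : lam ≤ 1) :
    IsDist fun A : Finset (Fin n) => lam ^ A.card * (1 - lam) ^ (n - A.card) := by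
  have := sub_nonneg.2 h1
  refine ⟨fun A => by positivity, ?_⟩
  rw [Fin.sum_pow_mul_eq_add_pow]
  simp

/-- The mean of the binomial distribution. -/
theorem sum_pow_mul_pow_mul_card (n : ℕ) (lam : ℝ) :
    ∑ A : Finset (Fin n), lam ^ A.card * (1 - lam) ^ (n - A.card) * (A.card : ℝ) = lam * n := by
  have h := congrArg (Polynomial.eval lam) (bernsteinPolynomial.sum_smul ℝ n)
  rw [Polynomial.eval_finsetSum] at h
  have h2 := sum_powerset_apply_card
    (fun k => lam ^ k * (1 - lam) ^ (n - k) * (k : ℝ)) (x := (univ : Finset (Fin n)))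
  rw [powerset_univ, card_univ, Fintype.card_fin] at h2
  rw [h2]
  simp only [nsmul_eq_mul, bernsteinPolynomial, Polynomial.eval_mul, Polynomial.eval_natCast,
    Polynomial.eval_pow, Polynomial.eval_X, Polynomial.eval_sub, Polynomial.eval_one] at h
  rw [mul_comm lam, ← h]
  exact sum_congr rfl fun k _ => by rw [nsmul_eq_mul]; ring

theorem Cdel_le_sum (n : ℕ) {lam d : ℝ} (h0 : 0 ≤ lam) (h1 : lam ≤ 1) (hd0 : 0 ≤ d)
    (hd1 : d ≤ 1) :
    Cdel n (lam * d + 1 - lam) ≤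
      ∑ A : Finset (Fin n), lam ^ A.card * (1 - lam) ^ (n - A.card) * Cdel A.card d := by
  have hw := isDist_pow_mul_pow n h0 h1
  refine csSup_le ⟨_, Pi.single (fun _ => false) 1, ⟨fun a => ?_, by simp⟩, rfl⟩ ?_
  · by_cases h : a = fun _ => false
    · simp [h]
    · simp [Pi.single_eq_of_ne h]
  rintro r ⟨p, hp, rfl⟩
  simp_rw [Wdel_eq_sum]
  refine (MI_mul_sum_le p _ (fun (A : Finset (Fin n)) (x : Fin n → Bool) =>
    Wdel A.card d (x ∘ A.orderEmbOfFin rfl)) _ hp.1 hw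
    (fun A x => Wdel_nonneg hd0 hd1 _) fun A x => ?_).trans ?_
  · exact sum_Wdel (by simpa using card_le_univ A) d _
  refine sum_le_sum fun A _ => mul_le_mul_of_nonneg_left ?_ (hw.1 A)
  have hA : A.card ≤ n := by simpa using card_le_univ A
  rw [MI_comp_eq (fun x : Fin n → Bool => x ∘ A.orderEmbOfFin rfl) p (Wdel A.card d) _
    (sum_Wdel hA d), MI_eq_of_subset _ (listsUpTo_mono hA)
      fun x y hy => by rw [Wdel_eq_zero d x hy, mul_zero]]
  exact MI_Wdel_le_Cdel hd0 hd1 (hp.pushDist _)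

theorem exists_le_mul_add_of_tendsto_div {f : ℕ → ℝ} {L M : ℝ}
    (hf : Filter.Tendsto (fun n : ℕ => f n / n) Filter.atTop (nhds L)) (hM : L < M) :
    ∃ K : ℝ, ∀ n : ℕ, f n ≤ M * n + K := by
  obtain ⟨N, hN⟩ := Filter.eventually_atTop.1
    ((hf.eventually_lt_const hM).and (Filter.eventually_gt_atTop 0))
  refine ⟨∑ k ∈ range N, |f k - M * k|, fun n => ?_⟩
  rcases lt_or_ge n N with h | h
  · have h1 := single_le_sum (f := fun k : ℕ => |f k - M * k|)
      (fun k _ => abs_nonneg _) (mem_range.2 h)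
    have h2 := le_abs_self (f n - M * n)
    linarith
  · obtain ⟨h1, h2⟩ := hN n h
    have h3 : (0 : ℝ) < n := Nat.cast_pos.2 h2
    have h4 : 0 ≤ ∑ k ∈ range N, |f k - M * k| := sum_nonneg fun k _ => abs_nonneg _
    rw [div_lt_iff₀ h3] at h1
    linarith

/-- Rahmati–Duman: Let `λ ∈ (0,1]`, `d' ∈ [0,1)` and
`d = λ·d' + 1 − λ`. Then `C(BDC_d)/(1−d) ≤ C(BDC_{d'})/(1−d')`; formally, for
all reals `L`, `L'`, if `C_n(d)/n → L` and `C_n(d')/n → L'`, then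
`L/(1−d) ≤ L'/(1−d')`. -/
theorem bdc_capacity_slope_mono (lam d' : ℝ) (hlam₀ : 0 < lam) (hlam₁ : lam ≤ 1)
    (hd'₀ : 0 ≤ d') (hd'₁ : d' < 1) (d : ℝ) (hd : d = lam * d' + 1 - lam)
    (L L' : ℝ)
    (hL : Filter.Tendsto (fun n : ℕ => Cdel n d / n) Filter.atTop (nhds L))
    (hL' : Filter.Tendsto (fun n : ℕ => Cdel n d' / n) Filter.atTop (nhds L')) :
    L / (1 - d) ≤ L' / (1 - d') := by
  subst hd
  have hd : 1 - (lam * d' + 1 - lam) = lam * (1 - d') := by ring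
  have hpos : 0 < 1 - d' := sub_pos.2 hd'₁
  rw [hd, ← div_div]
  refine div_le_div_of_nonneg_right ?_ hpos.le
  rw [div_le_iff₀' hlam₀, ← div_le_iff₀' hlam₀]
  refine le_of_forall_gt_imp_ge_of_dense fun M hM => ?_
  obtain ⟨K, hK⟩ := exists_le_mul_add_of_tendsto_div hL' hM
  rw [div_le_iff₀' hlam₀]
  have hbound : ∀ n : ℕ, Cdel n (lam * d' + 1 - lam) ≤ lam * M * n + K := by
    intro n
    have hw := isDist_pow_mul_pow n hlam₀.le hlam₁
    calc Cdel n (lam * d' + 1 - lam)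
        ≤ ∑ A : Finset (Fin n), lam ^ A.card * (1 - lam) ^ (n - A.card) * Cdel A.card d' :=
          Cdel_le_sum n hlam₀.le hlam₁ hd'₀ hd'₁.le
      _ ≤ ∑ A : Finset (Fin n), lam ^ A.card * (1 - lam) ^ (n - A.card) * (M * A.card + K) :=
          sum_le_sum fun A _ => mul_le_mul_of_nonneg_left (hK _) (hw.1 A)
      _ = M * (∑ A : Finset (Fin n), lam ^ A.card * (1 - lam) ^ (n - A.card) * (A.card : ℝ)) +
            (∑ A : Finset (Fin n), lam ^ A.card * (1 - lam) ^ (n - A.card)) * K := by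
          rw [mul_sum, sum_mul, ← sum_add_distrib]
          exact sum_congr rfl fun A _ => by ring
      _ = lam * M * n + K := by
          rw [sum_pow_mul_pow_mul_card, hw.2]
          ring
  have hlim : Filter.Tendsto (fun n : ℕ => lam * M + K / n) Filter.atTop (nhds (lam * M)) := by
    simpa using (tendsto_const_div_atTop_nhds_zero_nat K).const_add (lam * M)
  refine le_of_tendsto_of_tendsto hL hlim ?_
  filter_upwards [Filter.eventually_gt_atTop 0] with n hn
  have hn' : (0 : ℝ) < n := Nat.cast_pos.2 hn
  rw [div_le_iff₀ hn', add_mul, div_mul_cancel₀ _ hn'.ne']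
  exact hbound n
end
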